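/- For n ≥ 2, every element of the reduced type-B Birman–Murakami–Wenzl algebra BB_n(R) is an R-linear combination of elements of the form w₁·γ·w₂, where w₁ and w₂ lie in the image of the canonical R-algebra homomorphism BB_{n−1}(R) → BB_n(R) and γ ∈ {1, e_{n−1}, X_{n−1}, Y'_n}. -/

import Mathlib

namespace BMWB

inductive Gen (n : ℕ) : Type
  | X : Fin (n - 1) → Gen n
  | Xinv : Fin (n - 1) → Gen n
  | Y : 0 < n → Gen n
  | Yinv : 0 < n → Gen n

variable (R : Type) [CommRing R]

def fX {n : ℕ} (i : Fin (n - 1)) : FreeAlgebra R (Gen n) := FreeAlgebra.ι R (Gen.X i)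
def fXinv {n : ℕ} (i : Fin (n - 1)) : FreeAlgebra R (Gen n) := FreeAlgebra.ι R (Gen.Xinv i)
def fY {n : ℕ} (h : 0 < n) : FreeAlgebra R (Gen n) := FreeAlgebra.ι R (Gen.Y h)
def fYinv {n : ℕ} (h : 0 < n) : FreeAlgebra R (Gen n) := FreeAlgebra.ι R (Gen.Yinv h)
def fe {n : ℕ} (deli : R) (i : Fin (n - 1)) : FreeAlgebra R (Gen n) :=
  1 - deli • (fX R i - fXinv R i)

variable (lam lami deli q0 q1 A : R) (n : ℕ)

/-- The defining relations of the reduced Birman-Murakami-Wenzl algebra of Coxeter type B. -/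
inductive Rel : FreeAlgebra R (Gen n) → FreeAlgebra R (Gen n) → Prop
  | XXinv (i : Fin (n - 1)) : Rel (fX R i * fXinv R i) 1
  | XinvX (i : Fin (n - 1)) : Rel (fXinv R i * fX R i) 1
  | YYinv (h : 0 < n) : Rel (fY R h * fYinv R h) 1
  | YinvY (h : 0 < n) : Rel (fYinv R h * fY R h) 1
  | comm (i j : Fin (n - 1)) (h : (j : ℕ) + 1 < (i : ℕ)) :
      Rel (fX R i * fX R j) (fX R j * fX R i)
  | braid (i j : Fin (n - 1)) (h : (i : ℕ) + 1 = (j : ℕ)) :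
      Rel (fX R i * fX R j * fX R i) (fX R j * fX R i * fX R j)
  | Xe (i : Fin (n - 1)) : Rel (fX R i * fe R deli i) (lam • fe R deli i)
  | eX (i : Fin (n - 1)) : Rel (fe R deli i * fX R i) (lam • fe R deli i)
  | eXe (i j : Fin (n - 1)) (h : (j : ℕ) + 1 = (i : ℕ)) :
      Rel (fe R deli i * fX R j * fe R deli i) (lami • fe R deli i)
  | eXinve (i j : Fin (n - 1)) (h : (j : ℕ) + 1 = (i : ℕ)) :
      Rel (fe R deli i * fXinv R j * fe R deli i) (lam • fe R deli i)
  | bYXYX (h : 0 < n) (i : Fin (n - 1)) (hi : (i : ℕ) = 0) :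
      Rel (fX R i * fY R h * fX R i * fY R h) (fY R h * fX R i * fY R h * fX R i)
  | Ysq (h : 0 < n) : Rel (fY R h * fY R h) (q1 • fY R h + q0 • (1 : FreeAlgebra R (Gen n)))
  | YXYe (h : 0 < n) (i : Fin (n - 1)) (hi : (i : ℕ) = 0) :
      Rel (fY R h * fX R i * fY R h * fe R deli i) (fe R deli i)
  | Ycomm (h : 0 < n) (i : Fin (n - 1)) (hi : 0 < (i : ℕ)) :
      Rel (fY R h * fX R i) (fX R i * fY R h)
  | eYe (h : 0 < n) (i : Fin (n - 1)) (hi : (i : ℕ) = 0) :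
      Rel (fe R deli i * fY R h * fe R deli i) (A • fe R deli i)

/-- The reduced Birman-Murakami-Wenzl algebra of Coxeter type B, `BB_n(R)`,
presented by generators and relations. -/
abbrev BB : Type := RingQuot (Rel R lam lami deli q0 q1 A n)

noncomputable def mk : FreeAlgebra R (Gen n) →ₐ[R] BB R lam lami deli q0 q1 A n :=
  RingQuot.mkAlgHom R (Rel R lam lami deli q0 q1 A n)

/-- The generator `Y` (junk value `1` if `n = 0`). -/
noncomputable def YY : BB R lam lami deli q0 q1 A n :=
  if h : 0 < n then mk R lam lami deli q0 q1 A n (fY R h) else 1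

/-- The inverse of the generator `Y`. -/
noncomputable def YYi : BB R lam lami deli q0 q1 A n :=
  if h : 0 < n then mk R lam lami deli q0 q1 A n (fYinv R h) else 1

/-- The generator `X_i`, `1 ≤ i ≤ n-1` (junk value `1` out of range). -/
noncomputable def XX (i : ℕ) : BB R lam lami deli q0 q1 A n :=
  if h : i - 1 < n - 1 then mk R lam lami deli q0 q1 A n (fX R ⟨i - 1, h⟩) else 1

/-- The inverse `X_i⁻¹`. -/
noncomputable def XXi (i : ℕ) : BB R lam lami deli q0 q1 A n :=
  if h : i - 1 < n - 1 then mk R lam lami deli q0 q1 A n (fXinv R ⟨i - 1, h⟩) else 1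

/-- The element `e_i := 1 - δ⁻¹ (X_i - X_i⁻¹)`. -/
noncomputable def ee (i : ℕ) : BB R lam lami deli q0 q1 A n :=
  1 - deli • (XX R lam lami deli q0 q1 A n i - XXi R lam lami deli q0 q1 A n i)

/-- `Y_i := X_{i-1} ⋯ X_1 Y X_1⁻¹ ⋯ X_{i-1}⁻¹`. -/
noncomputable def Yn : ℕ → BB R lam lami deli q0 q1 A n
  | 0 => 1
  | 1 => YY R lam lami deli q0 q1 A n
  | (k + 2) => XX R lam lami deli q0 q1 A n (k + 1) * Yn (k + 1) * XXi R lam lami deli q0 q1 A n (k + 1)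

/-- `Y'_i := X_{i-1} ⋯ X_1 Y X_1 ⋯ X_{i-1}`. -/
noncomputable def Yp : ℕ → BB R lam lami deli q0 q1 A n
  | 0 => 1
  | 1 => YY R lam lami deli q0 q1 A n
  | (k + 2) => XX R lam lami deli q0 q1 A n (k + 1) * Yp (k + 1) * XX R lam lami deli q0 q1 A n (k + 1)

/-- The inverse of `Y'_i`. -/
noncomputable def Ypi : ℕ → BB R lam lami deli q0 q1 A n
  | 0 => 1
  | 1 => YYi R lam lami deli q0 q1 A n
  | (k + 2) => XXi R lam lami deli q0 q1 A n (k + 1) * Ypi (k + 1) * XXi R lam lami deli q0 q1 A n (k + 1)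

/-- The set of the images of the generators (and their inverses) of `BB_{m+1}` inside `BB_n`.
Its `Algebra.adjoin` is the image of the canonical algebra homomorphism `BB_{m+1} → BB_n`. -/
noncomputable def genSet (m : ℕ) : Set (BB R lam lami deli q0 q1 A n) :=
  {a | a = YY R lam lami deli q0 q1 A n ∨ a = YYi R lam lami deli q0 q1 A n ∨
    ∃ i, 1 ≤ i ∧ i ≤ m ∧ (a = XX R lam lami deli q0 q1 A n i ∨ a = XXi R lam lami deli q0 q1 A n i)}

/-- The image of the canonical algebra homomorphism `BB_{m+1}(R) → BB_n(R)`, realized as the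
subalgebra generated by the images of the generators `Y, Y⁻¹, X_1, …, X_m` (and inverses). -/
noncomputable def sub (m : ℕ) : Subalgebra R (BB R lam lami deli q0 q1 A n) :=
  Algebra.adjoin R (genSet R lam lami deli q0 q1 A n m)

/-- `X(i,j) = X_i X_{i+1} ⋯ X_j`. -/
noncomputable def Xprod (i j : ℕ) : BB R lam lami deli q0 q1 A n :=
  ((List.range (j + 1 - i)).map (fun k => XX R lam lami deli q0 q1 A n (i + k))).prod

/-- `E(i,j) = e_i e_{i+2} ⋯ e_j`. -/
noncomputable def Eprod (i j : ℕ) : BB R lam lami deli q0 q1 A n :=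
  ((List.range ((j - i) / 2 + 1)).map (fun k => ee R lam lami deli q0 q1 A n (i + 2 * k))).prod

/-- `H_1 = e_1`, `H_{m+1} = e_{m+1} X(m+2, 2m+1) X(m+1, 2m) H_m`. -/
noncomputable def H : ℕ → BB R lam lami deli q0 q1 A n
  | 0 => 1
  | 1 => ee R lam lami deli q0 q1 A n 1
  | (k + 2) => ee R lam lami deli q0 q1 A n (k + 2) *
      Xprod R lam lami deli q0 q1 A n (k + 3) (2 * k + 3) *
      Xprod R lam lami deli q0 q1 A n (k + 2) (2 * k + 2) * H (k + 1)

/-- Semiconjugation passes to inverses. -/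
theorem semiconjBy_inverse {B : Type*} [Monoid B] {a x xi y yi : B} (hx : x * xi = 1)
    (hy : yi * y = 1) (h : SemiconjBy a x y) : SemiconjBy a xi yi := by
  calc a * xi = yi * (y * a) * xi := by rw [← mul_assoc, hy, one_mul]
    _ = yi * a * (x * xi) := by rw [← h.eq]; simp only [mul_assoc]
    _ = yi * a := by rw [hx, mul_one]

section Tangle

variable {R B : Type*} [CommRing R] [Ring B] [Algebra R B]

/-- The element `1 - δ⁻¹ (X - X⁻¹)`. -/
def cupCap (deli : R) (X Xi : B) : B := 1 - deli • (X - Xi)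

theorem semiconjBy_cupCap (deli : R) {a x xi y yi : B} (hx : x * xi = 1) (hy : yi * y = 1)
    (h : SemiconjBy a x y) : SemiconjBy a (cupCap deli x xi) (cupCap deli y yi) := by
  have h' := (semiconjBy_inverse hx hy h).eq
  have h := h.eq
  simp only [SemiconjBy, cupCap, mul_sub, sub_mul, mul_smul_comm, smul_mul_assoc, mul_one,
    one_mul, smul_sub, h, h']

theorem sub_inverse_eq {del deli : R} (hdel : del * deli = 1) (X Xi : B) :
    X - Xi = del • (1 - cupCap deli X Xi) := by
  simp [cupCap, smul_smul, hdel]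

theorem mul_self_eq {del deli lam : R} {X Xi : B} (hdel : del * deli = 1) (hX : X * Xi = 1)
    (hXe : X * cupCap deli X Xi = lam • cupCap deli X Xi) :
    X * X = 1 + del • X - (del * lam) • cupCap deli X Xi := by
  have h := congrArg (X * ·) (sub_inverse_eq hdel X Xi)
  simp only [mul_sub, hX, mul_smul_comm, mul_one, hXe, smul_sub, smul_smul] at h
  rw [sub_eq_iff_eq_add] at h
  rw [h]
  abel

/-- The relations between two consecutive generators `Z = X_i` and `X = X_{i+1}`. -/
structure Adjacent (lam lami deli : R) (Z Zi X Xi : B) : Prop where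
  lam_mul : lam * lami = 1
  Z_mul : Z * Zi = 1
  Zi_mul : Zi * Z = 1
  X_mul : X * Xi = 1
  Xi_mul : Xi * X = 1
  braid : Z * X * Z = X * Z * X
  X_e : X * cupCap deli X Xi = lam • cupCap deli X Xi
  e_X : cupCap deli X Xi * X = lam • cupCap deli X Xi
  e_Z_e : cupCap deli X Xi * Z * cupCap deli X Xi = lami • cupCap deli X Xi
  e_Zi_e : cupCap deli X Xi * Zi * cupCap deli X Xi = lam • cupCap deli X Xi

namespace Adjacent


variable {lam lami deli : R} {Z Zi X Xi : B}

theorem Xi_e (h : Adjacent lam lami deli Z Zi X Xi) :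
    Xi * cupCap deli X Xi = lami • cupCap deli X Xi := by
  calc Xi * cupCap deli X Xi = lami • (Xi * (lam • cupCap deli X Xi)) := by
        rw [mul_smul_comm, smul_smul, mul_comm lami, h.lam_mul, one_smul]
    _ = lami • cupCap deli X Xi := by rw [← h.X_e, ← mul_assoc, h.Xi_mul, one_mul]

theorem e_Xi (h : Adjacent lam lami deli Z Zi X Xi) :
    cupCap deli X Xi * Xi = lami • cupCap deli X Xi := by
  calc cupCap deli X Xi * Xi = lami • ((lam • cupCap deli X Xi) * Xi) := by
        rw [smul_mul_assoc, smul_smul, mul_comm lami, h.lam_mul, one_smul]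
    _ = lami • cupCap deli X Xi := by rw [← h.e_X, mul_assoc, h.X_mul, mul_one]

theorem Z_X_f (h : Adjacent lam lami deli Z Zi X Xi) :
    Z * X * cupCap deli Z Zi = cupCap deli X Xi * (Z * X) :=
  (semiconjBy_cupCap deli h.Z_mul h.Xi_mul
    (by rw [SemiconjBy, h.braid, mul_assoc] : SemiconjBy (Z * X) Z X)).eq

theorem X_Z_e (h : Adjacent lam lami deli Z Zi X Xi) :
    X * Z * cupCap deli X Xi = cupCap deli Z Zi * (X * Z) :=
  (semiconjBy_cupCap deli h.X_mul h.Zi_mul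
    (by rw [SemiconjBy, ← h.braid, mul_assoc] : SemiconjBy (X * Z) X Z)).eq

theorem f_Xi_Zi (h : Adjacent lam lami deli Z Zi X Xi) :
    cupCap deli Z Zi * (Xi * Zi) = Xi * Zi * cupCap deli X Xi := by
  calc cupCap deli Z Zi * (Xi * Zi)
      = Xi * (Zi * Z) * X * cupCap deli Z Zi * (Xi * Zi) := by simp [h.Zi_mul, h.Xi_mul]
    _ = Xi * Zi * (Z * X * cupCap deli Z Zi) * (Xi * Zi) := by simp only [mul_assoc]
    _ = Xi * Zi * cupCap deli X Xi * (Z * (X * Xi) * Zi) := by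
        rw [h.Z_X_f]; simp only [mul_assoc]
    _ = Xi * Zi * cupCap deli X Xi := by simp [h.X_mul, h.Z_mul]

theorem Zi_Xi_f (h : Adjacent lam lami deli Z Zi X Xi) :
    Zi * Xi * cupCap deli Z Zi = cupCap deli X Xi * (Zi * Xi) := by
  calc Zi * Xi * cupCap deli Z Zi
      = Zi * Xi * (cupCap deli Z Zi * (X * (Z * Zi) * Xi)) := by simp [h.X_mul, h.Z_mul]
    _ = Zi * Xi * ((cupCap deli Z Zi * (X * Z)) * (Zi * Xi)) := by simp only [mul_assoc]
    _ = Zi * (Xi * X) * Z * (cupCap deli X Xi * (Zi * Xi)) := by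
        rw [← h.X_Z_e]; simp only [mul_assoc]
    _ = cupCap deli X Xi * (Zi * Xi) := by simp [h.Xi_mul, h.Zi_mul]

theorem e_f_eq (h : Adjacent lam lami deli Z Zi X Xi) :
    cupCap deli X Xi * cupCap deli Z Zi = cupCap deli X Xi * Z * X := by
  calc cupCap deli X Xi * cupCap deli Z Zi
      = cupCap deli X Xi * cupCap deli Z Zi * (Xi * (Zi * Z) * X) := by
        simp [h.Zi_mul, h.Xi_mul]
    _ = cupCap deli X Xi * (cupCap deli Z Zi * (Xi * Zi)) * Z * X := by simp only [mul_assoc]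
    _ = cupCap deli X Xi * Xi * Zi * cupCap deli X Xi * Z * X := by
        rw [h.f_Xi_Zi]; simp only [mul_assoc]
    _ = cupCap deli X Xi * Z * X := by
        rw [h.e_Xi, smul_mul_assoc, smul_mul_assoc, h.e_Zi_e, smul_smul, mul_comm lami,
          h.lam_mul, one_smul]

theorem e_f_eq_inverse (h : Adjacent lam lami deli Z Zi X Xi) :
    cupCap deli X Xi * cupCap deli Z Zi = cupCap deli X Xi * Zi * Xi := by
  calc cupCap deli X Xi * cupCap deli Z Zi
      = cupCap deli X Xi * cupCap deli Z Zi * (X * (Z * Zi) * Xi) := by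
        simp [h.Z_mul, h.X_mul]
    _ = cupCap deli X Xi * (cupCap deli Z Zi * (X * Z)) * Zi * Xi := by simp only [mul_assoc]
    _ = cupCap deli X Xi * X * Z * cupCap deli X Xi * Zi * Xi := by
        rw [← h.X_Z_e]; simp only [mul_assoc]
    _ = cupCap deli X Xi * Zi * Xi := by
        rw [h.e_X, smul_mul_assoc, smul_mul_assoc, h.e_Z_e, smul_smul,
          h.lam_mul, one_smul]

theorem f_e_eq (h : Adjacent lam lami deli Z Zi X Xi) :
    cupCap deli Z Zi * cupCap deli X Xi = X * Z * cupCap deli X Xi := by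
  calc cupCap deli Z Zi * cupCap deli X Xi
      = X * (Z * Zi) * Xi * cupCap deli Z Zi * cupCap deli X Xi := by
        simp [h.Z_mul, h.X_mul]
    _ = X * Z * (Zi * Xi * cupCap deli Z Zi) * cupCap deli X Xi := by simp only [mul_assoc]
    _ = X * Z * (cupCap deli X Xi * Zi * (Xi * cupCap deli X Xi)) := by
        rw [h.Zi_Xi_f]; simp only [mul_assoc]
    _ = X * Z * cupCap deli X Xi := by
        rw [h.Xi_e, mul_smul_comm, h.e_Zi_e, smul_smul, mul_comm lami, h.lam_mul, one_smul]

theorem X_f_e (h : Adjacent lam lami deli Z Zi X Xi) :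
    X * cupCap deli Z Zi * cupCap deli X Xi = Zi * cupCap deli X Xi := by
  calc X * cupCap deli Z Zi * cupCap deli X Xi
      = Zi * Z * X * cupCap deli Z Zi * cupCap deli X Xi := by simp [h.Zi_mul]
    _ = Zi * (Z * X * cupCap deli Z Zi) * cupCap deli X Xi := by simp only [mul_assoc]
    _ = Zi * (cupCap deli X Xi * Z * (X * cupCap deli X Xi)) := by
        rw [h.Z_X_f]; simp only [mul_assoc]
    _ = Zi * cupCap deli X Xi := by
        rw [h.X_e, mul_smul_comm, h.e_Z_e, smul_smul, h.lam_mul, one_smul]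

theorem X_f_X (h : Adjacent lam lami deli Z Zi X Xi) :
    X * cupCap deli Z Zi * X = Zi * cupCap deli X Xi * Zi := by
  calc X * cupCap deli Z Zi * X
      = Zi * Z * X * cupCap deli Z Zi * X := by simp [h.Zi_mul]
    _ = Zi * (Z * X * cupCap deli Z Zi) * X := by simp only [mul_assoc]
    _ = Zi * (cupCap deli X Xi * Z * X) * X := by rw [h.Z_X_f]; simp only [mul_assoc]
    _ = Zi * (cupCap deli X Xi * Zi) * (Xi * X) := by
        rw [← h.e_f_eq, h.e_f_eq_inverse]; simp only [mul_assoc]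
    _ = Zi * cupCap deli X Xi * Zi := by rw [h.Xi_mul, mul_one, mul_assoc]

end Adjacent

/-- Generators `Y, X_1, …, X_N` of an algebra satisfying the defining relations of the reduced
Birman–Murakami–Wenzl algebra of Coxeter type B. -/
structure TypeBRelations (lam lami deli q0 q1 : R) (N : ℕ) (X Xi : ℕ → B) (Y Yi : B) :
    Prop where
  X_mul : ∀ i, 1 ≤ i → i ≤ N → X i * Xi i = 1
  Xi_mul : ∀ i, 1 ≤ i → i ≤ N → Xi i * X i = 1
  Y_mul : Y * Yi = 1
  Yi_mul : Yi * Y = 1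
  comm : ∀ i j, 1 ≤ i → i + 1 < j → j ≤ N → Commute (X i) (X j)
  braid : ∀ i, 1 ≤ i → i + 1 ≤ N → X i * X (i + 1) * X i = X (i + 1) * X i * X (i + 1)
  X_e : ∀ i, 1 ≤ i → i ≤ N →
    X i * cupCap deli (X i) (Xi i) = lam • cupCap deli (X i) (Xi i)
  e_X : ∀ i, 1 ≤ i → i ≤ N →
    cupCap deli (X i) (Xi i) * X i = lam • cupCap deli (X i) (Xi i)
  e_X_e : ∀ i, 1 ≤ i → i + 1 ≤ N →
    cupCap deli (X (i + 1)) (Xi (i + 1)) * X i * cupCap deli (X (i + 1)) (Xi (i + 1)) =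
      lami • cupCap deli (X (i + 1)) (Xi (i + 1))
  e_Xi_e : ∀ i, 1 ≤ i → i + 1 ≤ N →
    cupCap deli (X (i + 1)) (Xi (i + 1)) * Xi i * cupCap deli (X (i + 1)) (Xi (i + 1)) =
      lam • cupCap deli (X (i + 1)) (Xi (i + 1))
  XYXY : 1 ≤ N → X 1 * Y * X 1 * Y = Y * X 1 * Y * X 1
  Y_sq : Y * Y = q1 • Y + q0 • (1 : B)
  YXY_e : 1 ≤ N → Y * X 1 * Y * cupCap deli (X 1) (Xi 1) = cupCap deli (X 1) (Xi 1)
  Y_comm : ∀ i, 2 ≤ i → i ≤ N → Commute Y (X i)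

/-- The Jucys–Murphy type element `X_k ⋯ X_1 Y X_1 ⋯ X_k`. -/
def murphy (X : ℕ → B) (Y : B) : ℕ → B
  | 0 => Y
  | k + 1 => X (k + 1) * murphy X Y k * X (k + 1)

variable (R) in
/-- The subalgebra generated by `Y^{±1}, X_1^{±1}, …, X_m^{±1}`. -/
def parabolic (X Xi : ℕ → B) (Y Yi : B) (m : ℕ) : Subalgebra R B :=
  Algebra.adjoin R {a | a = Y ∨ a = Yi ∨ ∃ i, 1 ≤ i ∧ i ≤ m ∧ (a = X i ∨ a = Xi i)}

variable (R) in
/-- The span of the words `a γ b` with `a, b` in the `m`-th parabolic subalgebra and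
`γ ∈ {1, e_{m+1}, X_{m+1}, Y'_{m+2}}`. -/
def normalForms (deli : R) (X Xi : ℕ → B) (Y Yi : B) (m : ℕ) : Submodule R B :=
  Submodule.span R {w | ∃ a ∈ parabolic R X Xi Y Yi m, ∃ b ∈ parabolic R X Xi Y Yi m,
    ∃ γ ∈ ({1, cupCap deli (X (m + 1)) (Xi (m + 1)), X (m + 1), murphy X Y (m + 1)} : Set B),
      w = a * γ * b}

section Parabolic

variable {X Xi : ℕ → B} {Y Yi : B}

theorem Y_mem_parabolic (m : ℕ) : Y ∈ parabolic R X Xi Y Yi m :=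
  Algebra.subset_adjoin (Or.inl rfl)

theorem Yi_mem_parabolic (m : ℕ) : Yi ∈ parabolic R X Xi Y Yi m :=
  Algebra.subset_adjoin (Or.inr (Or.inl rfl))

theorem X_mem_parabolic {i m : ℕ} (h1 : 1 ≤ i) (h2 : i ≤ m) :
    X i ∈ parabolic R X Xi Y Yi m :=
  Algebra.subset_adjoin (Or.inr (Or.inr ⟨i, h1, h2, Or.inl rfl⟩))

theorem Xi_mem_parabolic {i m : ℕ} (h1 : 1 ≤ i) (h2 : i ≤ m) :
    Xi i ∈ parabolic R X Xi Y Yi m :=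
  Algebra.subset_adjoin (Or.inr (Or.inr ⟨i, h1, h2, Or.inr rfl⟩))

theorem parabolic_mono {l m : ℕ} (h : l ≤ m) :
    parabolic R X Xi Y Yi l ≤ parabolic R X Xi Y Yi m := by
  refine Algebra.adjoin_mono ?_
  rintro a (ha | ha | ⟨i, h1, h2, ha⟩)
  · exact Or.inl ha
  · exact Or.inr (Or.inl ha)
  · exact Or.inr (Or.inr ⟨i, h1, h2.trans h, ha⟩)

theorem murphy_mem_parabolic {k m : ℕ} (h : k ≤ m) :
    murphy X Y k ∈ parabolic R X Xi Y Yi m := by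
  induction k with
  | zero => exact Y_mem_parabolic m
  | succ k ih =>
    have hX : X (k + 1) ∈ parabolic R X Xi Y Yi m := X_mem_parabolic (by omega) h
    exact mul_mem (mul_mem hX (ih (by omega))) hX

theorem murphy_inverse_mem_parabolic {k m : ℕ} (h : k ≤ m) :
    murphy Xi Yi k ∈ parabolic R X Xi Y Yi m := by
  induction k with
  | zero => exact Yi_mem_parabolic m
  | succ k ih =>
    have hX : Xi (k + 1) ∈ parabolic R X Xi Y Yi m := Xi_mem_parabolic (by omega) h
    exact mul_mem (mul_mem hX (ih (by omega))) hX

theorem cupCap_mem {S : Subalgebra R B} (deli : R) {x xi : B} (hx : x ∈ S) (hxi : xi ∈ S) :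
    cupCap deli x xi ∈ S :=
  sub_mem (one_mem S) (S.smul_mem (sub_mem hx hxi) deli)

theorem mul_mem_normalForms {deli : R} {m : ℕ} {u v w : B} (hu : u ∈ parabolic R X Xi Y Yi m)
    (hv : v ∈ parabolic R X Xi Y Yi m) (hw : w ∈ normalForms R deli X Xi Y Yi m) :
    u * w * v ∈ normalForms R deli X Xi Y Yi m := by
  induction hw using Submodule.span_induction with
  | mem w hw =>
    obtain ⟨a, ha, b, hb, γ, hγ, rfl⟩ := hw
    exact Submodule.subset_span
      ⟨u * a, mul_mem hu ha, b * v, mul_mem hb hv, γ, hγ, by simp only [mul_assoc]⟩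
  | zero => simp
  | add w w' _ _ h h' => rw [mul_add, add_mul]; exact add_mem h h'
  | smul c w _ h => rw [mul_smul_comm, smul_mul_assoc]; exact Submodule.smul_mem _ c h

theorem basic_mem_normalForms {deli : R} {m : ℕ} {γ : B}
    (hγ : γ ∈ ({1, cupCap deli (X (m + 1)) (Xi (m + 1)), X (m + 1),
      murphy X Y (m + 1)} : Set B)) :
    γ ∈ normalForms R deli X Xi Y Yi m :=
  Submodule.subset_span ⟨1, one_mem _, 1, one_mem _, γ, hγ, by simp⟩

theorem mem_normalForms_of_mem_parabolic (deli : R) {m : ℕ} {u : B}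
    (hu : u ∈ parabolic R X Xi Y Yi m) : u ∈ normalForms R deli X Xi Y Yi m := by
  have := mul_mem_normalForms hu (one_mem _)
    (basic_mem_normalForms (R := R) (deli := deli) (X := X) (Xi := Xi) (Y := Y) (Yi := Yi)
      (m := m) (γ := 1) (by simp))
  simpa using this

end Parabolic

namespace TypeBRelations

variable {lam lami deli q0 q1 : R} {N : ℕ} {X Xi : ℕ → B} {Y Yi : B}

theorem adjacent (h : TypeBRelations lam lami deli q0 q1 N X Xi Y Yi) (hlam : lam * lami = 1)
    {i : ℕ} (h1 : 1 ≤ i) (hN : i + 1 ≤ N) :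
    Adjacent lam lami deli (X i) (Xi i) (X (i + 1)) (Xi (i + 1)) where
  lam_mul := hlam
  Z_mul := h.X_mul i h1 (by omega)
  Zi_mul := h.Xi_mul i h1 (by omega)
  X_mul := h.X_mul _ (by omega) hN
  Xi_mul := h.Xi_mul _ (by omega) hN
  braid := h.braid i h1 hN
  X_e := h.X_e _ (by omega) hN
  e_X := h.e_X _ (by omega) hN
  e_Z_e := h.e_X_e i h1 hN
  e_Zi_e := h.e_Xi_e i h1 hN

theorem commute_parabolic (h : TypeBRelations lam lami deli q0 q1 N X Xi Y Yi) {c : B} {m : ℕ}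
    (hm : m ≤ N) (hY : Commute c Y) (hX : ∀ i, 1 ≤ i → i ≤ m → Commute c (X i)) {a : B}
    (ha : a ∈ parabolic R X Xi Y Yi m) : Commute c a := by
  refine Algebra.adjoin_induction (p := fun a _ ↦ Commute c a) ?_ ?_ ?_ ?_ ha
  · rintro a (rfl | rfl | ⟨i, h1, h2, rfl | rfl⟩)
    · exact hY
    · exact semiconjBy_inverse h.Y_mul h.Yi_mul hY
    · exact hX i h1 h2
    · exact semiconjBy_inverse (h.X_mul i h1 (by omega)) (h.Xi_mul i h1 (by omega)) (hX i h1 h2)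
  · exact fun r ↦ (Algebra.commutes r c).symm
  · exact fun _ _ _ _ ↦ Commute.add_right
  · exact fun _ _ _ _ ↦ Commute.mul_right

theorem X_commute_parabolic (h : TypeBRelations lam lami deli q0 q1 N X Xi Y Yi) {m j : ℕ}
    (hmj : m + 2 ≤ j) (hj : j ≤ N) {a : B} (ha : a ∈ parabolic R X Xi Y Yi m) :
    Commute (X j) a :=
  h.commute_parabolic (by omega) (h.Y_comm j (by omega) hj).symm
    (fun i h1 h2 ↦ (h.comm i j h1 (by omega) hj).symm) ha

theorem murphy_commute_Y_and_X (h : TypeBRelations lam lami deli q0 q1 N X Xi Y Yi) (k : ℕ)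
    (hk : k + 1 ≤ N) : Commute (murphy X Y (k + 1)) Y ∧
      ∀ i, 1 ≤ i → i ≤ k → Commute (murphy X Y (k + 1)) (X i) := by
  induction k with
  | zero =>
    refine ⟨?_, fun i h1 h2 ↦ by omega⟩
    have := h.XYXY hk
    simp only [murphy, Commute, SemiconjBy, zero_add, mul_assoc] at this ⊢
    exact this
  | succ k ih =>
    obtain ⟨ihY, ihX⟩ := ih (by omega)
    have hY := h.Y_comm (k + 2) (by omega) hk
    refine ⟨(hY.symm.mul_left ihY).mul_left hY.symm, fun i h1 h2 ↦ ?_⟩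
    rcases Nat.lt_or_ge i (k + 1) with hi | hi
    · have hX := (h.comm i (k + 2) h1 (by omega) hk).symm
      exact (hX.mul_left (ihX i h1 (by omega))).mul_left hX
    · obtain rfl : i = k + 1 := by omega
      have hb := h.braid (k + 1) h1 hk
      have hc : Commute (X (k + 2)) (murphy X Y k) :=
        h.X_commute_parabolic (m := k) le_rfl hk (murphy_mem_parabolic le_rfl)
      have hc := hc.eq
      simp only [murphy, Commute, SemiconjBy]
      generalize murphy X Y k = V at *
      generalize X (k + 1) = Z at *
      change Z * X (k + 2) * Z = X (k + 2) * Z * X (k + 2) at hb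
      change X (k + 2) * (Z * V * Z) * X (k + 2) * Z = Z * (X (k + 2) * (Z * V * Z) * X (k + 2))
      generalize X (k + 2) = W at *
      calc W * (Z * V * Z) * W * Z = W * Z * V * (Z * W * Z) := by simp only [mul_assoc]
        _ = W * Z * (V * W) * Z * W := by rw [hb]; simp only [mul_assoc]
        _ = (W * Z * W) * V * Z * W := by rw [← hc]; simp only [mul_assoc]
        _ = Z * (W * (Z * V * Z) * W) := by rw [← hb]; simp only [mul_assoc]

theorem murphy_commute (h : TypeBRelations lam lami deli q0 q1 N X Xi Y Yi) {k : ℕ}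
    (hk : k + 1 ≤ N) {a : B} (ha : a ∈ parabolic R X Xi Y Yi k) :
    Commute (murphy X Y (k + 1)) a :=
  h.commute_parabolic (by omega) (h.murphy_commute_Y_and_X k hk).1
    (h.murphy_commute_Y_and_X k hk).2 ha

theorem murphy_mul_inverse (h : TypeBRelations lam lami deli q0 q1 N X Xi Y Yi) {k : ℕ}
    (hk : k ≤ N) : murphy X Y k * murphy Xi Yi k = 1 := by
  induction k with
  | zero => exact h.Y_mul
  | succ k ih =>
    calc X (k + 1) * murphy X Y k * X (k + 1) * (Xi (k + 1) * murphy Xi Yi k * Xi (k + 1))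
        = X (k + 1) * murphy X Y k * (X (k + 1) * Xi (k + 1)) * murphy Xi Yi k * Xi (k + 1) := by
          simp only [mul_assoc]
      _ = X (k + 1) * (murphy X Y k * murphy Xi Yi k) * Xi (k + 1) := by
          rw [h.X_mul _ (by omega) hk, mul_one]; simp only [mul_assoc]
      _ = 1 := by rw [ih (by omega), mul_one, h.X_mul _ (by omega) hk]

theorem inverse_mul_murphy (h : TypeBRelations lam lami deli q0 q1 N X Xi Y Yi) {k : ℕ}
    (hk : k ≤ N) : murphy Xi Yi k * murphy X Y k = 1 := by
  induction k with
  | zero => exact h.Yi_mul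
  | succ k ih =>
    calc Xi (k + 1) * murphy Xi Yi k * Xi (k + 1) * (X (k + 1) * murphy X Y k * X (k + 1))
        = Xi (k + 1) * murphy Xi Yi k * (Xi (k + 1) * X (k + 1)) * murphy X Y k * X (k + 1) := by
          simp only [mul_assoc]
      _ = Xi (k + 1) * (murphy Xi Yi k * murphy X Y k) * X (k + 1) := by
          rw [h.Xi_mul _ (by omega) hk, mul_one]; simp only [mul_assoc]
      _ = 1 := by rw [ih (by omega), mul_one, h.Xi_mul _ (by omega) hk]

theorem murphy_X_murphy_e (h : TypeBRelations lam lami deli q0 q1 N X Xi Y Yi)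
    (hlam : lam * lami = 1) {k : ℕ} (hk : k + 1 ≤ N) :
    murphy X Y k * X (k + 1) * murphy X Y k * cupCap deli (X (k + 1)) (Xi (k + 1)) =
      cupCap deli (X (k + 1)) (Xi (k + 1)) := by
  induction k with
  | zero => exact h.YXY_e hk
  | succ k ih =>
    have ih := ih (by omega)
    have hc : Commute (X (k + 2)) (murphy X Y k) :=
      h.X_commute_parabolic (m := k) le_rfl hk (murphy_mem_parabolic le_rfl)
    have hc := hc.eq
    have ha := h.adjacent hlam (i := k + 1) (by omega) hk
    have hf : cupCap deli (X (k + 1)) (Xi (k + 1)) * cupCap deli (X (k + 2)) (Xi (k + 2)) =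
      X (k + 2) * X (k + 1) * cupCap deli (X (k + 2)) (Xi (k + 2)) := ha.f_e_eq
    have hXf : X (k + 2) * cupCap deli (X (k + 1)) (Xi (k + 1)) *
      cupCap deli (X (k + 2)) (Xi (k + 2)) =
        Xi (k + 1) * cupCap deli (X (k + 2)) (Xi (k + 2)) := ha.X_f_e
    have hb : X (k + 1) * X (k + 2) * X (k + 1) = X (k + 2) * X (k + 1) * X (k + 2) := ha.braid
    have hZ := ha.Z_mul
    change X (k + 1) * murphy X Y k * X (k + 1) * X (k + 2) *
      (X (k + 1) * murphy X Y k * X (k + 1)) * cupCap deli (X (k + 2)) (Xi (k + 2)) =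
        cupCap deli (X (k + 2)) (Xi (k + 2))
    generalize cupCap deli (X (k + 2)) (Xi (k + 2)) = e at *
    generalize cupCap deli (X (k + 1)) (Xi (k + 1)) = f at *
    generalize X (k + 2) = W at *
    generalize X (k + 1) = Z at *
    generalize murphy X Y k = V at *
    calc Z * V * Z * W * (Z * V * Z) * e = Z * V * (Z * W * Z) * V * Z * e := by
          simp only [mul_assoc]
      _ = Z * (V * W) * Z * (W * V) * Z * e := by rw [hb]; simp only [mul_assoc]
      _ = Z * (W * V) * Z * (V * W) * Z * e := by rw [hc]
      _ = Z * W * V * Z * V * (W * Z * e) := by simp only [mul_assoc]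
      _ = Z * W * (V * Z * V * f) * e := by rw [← hf]; simp only [mul_assoc]
      _ = Z * (W * f * e) := by rw [ih]; simp only [mul_assoc]
      _ = e := by rw [hXf, ← mul_assoc, hZ, one_mul]

theorem X_murphy_e (h : TypeBRelations lam lami deli q0 q1 N X Xi Y Yi)
    (hlam : lam * lami = 1) {k : ℕ} (hk : k + 1 ≤ N) :
    X (k + 1) * murphy X Y k * cupCap deli (X (k + 1)) (Xi (k + 1)) =
      murphy Xi Yi k * cupCap deli (X (k + 1)) (Xi (k + 1)) := by
  calc X (k + 1) * murphy X Y k * cupCap deli (X (k + 1)) (Xi (k + 1))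
      = (murphy Xi Yi k * murphy X Y k) * (X (k + 1) * murphy X Y k *
          cupCap deli (X (k + 1)) (Xi (k + 1))) := by
        rw [h.inverse_mul_murphy (by omega), one_mul]
    _ = murphy Xi Yi k * (murphy X Y k * X (k + 1) * murphy X Y k *
          cupCap deli (X (k + 1)) (Xi (k + 1))) := by simp only [mul_assoc]
    _ = _ := by rw [h.murphy_X_murphy_e hlam hk]

theorem e_murphy_X (h : TypeBRelations lam lami deli q0 q1 N X Xi Y Yi)
    (hlam : lam * lami = 1) {k : ℕ} (hk : k + 1 ≤ N) :
    cupCap deli (X (k + 1)) (Xi (k + 1)) * murphy X Y k * X (k + 1) =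
      cupCap deli (X (k + 1)) (Xi (k + 1)) * murphy Xi Yi k := by
  have hc : Commute (murphy X Y k * X (k + 1) * murphy X Y k) (X (k + 1)) := by
    have := (h.murphy_commute hk (murphy_mem_parabolic le_rfl)).eq
    simp only [murphy, Commute, SemiconjBy, mul_assoc] at this ⊢
    exact this.symm
  have he := semiconjBy_cupCap deli (h.X_mul (k + 1) (by omega) hk)
    (h.Xi_mul (k + 1) (by omega) hk) hc
  have he := he.eq
  rw [h.murphy_X_murphy_e hlam hk] at he
  calc cupCap deli (X (k + 1)) (Xi (k + 1)) * murphy X Y k * X (k + 1)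
      = cupCap deli (X (k + 1)) (Xi (k + 1)) * murphy X Y k * X (k + 1) *
          (murphy X Y k * murphy Xi Yi k) := by
        rw [h.murphy_mul_inverse (by omega), mul_one]
    _ = cupCap deli (X (k + 1)) (Xi (k + 1)) * (murphy X Y k * X (k + 1) * murphy X Y k) *
          murphy Xi Yi k := by simp only [mul_assoc]
    _ = _ := by rw [← he]

variable (R) in
/-- The words `a γ b` where `a, b` lie in the `k`-th parabolic subalgebra and commute with
`X_{k+1}`, and `γ ∈ {1, Y'_{k+1}}` or `γ ∈ {e_k, X_k}` with `1 ≤ k`. -/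
def centralizedWords (deli : R) (X Xi : ℕ → B) (Y Yi : B) (k : ℕ) : Set B :=
  {w | ∃ a ∈ parabolic R X Xi Y Yi k, ∃ b ∈ parabolic R X Xi Y Yi k,
    Commute (X (k + 1)) a ∧ Commute (X (k + 1)) b ∧
    ∃ γ, (γ = 1 ∨ γ = murphy X Y k ∨ (1 ≤ k ∧ (γ = cupCap deli (X k) (Xi k) ∨ γ = X k))) ∧
      w = a * γ * b}

theorem X_mul_mul_mem (h : TypeBRelations lam lami deli q0 q1 N X Xi Y Yi)
    (hlam : lam * lami = 1) {del : R} (hdel : del * deli = 1) {k : ℕ} (hk : k + 1 ≤ N) {g γ : B}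
    (hg : g = 1 ∨ g = murphy X Y k ∨ (1 ≤ k ∧ (g = cupCap deli (X k) (Xi k) ∨ g = X k)))
    (hγ : γ ∈ ({1, cupCap deli (X (k + 1)) (Xi (k + 1)), X (k + 1),
      murphy X Y (k + 1)} : Set B)) :
    X (k + 1) * g * γ ∈ normalForms R deli X Xi Y Yi k := by
  have hXX := mul_self_eq hdel (h.X_mul (k + 1) (by omega) hk) (h.X_e (k + 1) (by omega) hk)
  have heM : cupCap deli (X (k + 1)) (Xi (k + 1)) ∈ normalForms R deli X Xi Y Yi k :=
    basic_mem_normalForms (by simp)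
  have hXM : X (k + 1) ∈ normalForms R deli X Xi Y Yi k := basic_mem_normalForms (by simp)
  have hYM : murphy X Y (k + 1) ∈ normalForms R deli X Xi Y Yi k :=
    basic_mem_normalForms (by simp)
  have hleft {u w : B} (hu : u ∈ parabolic R X Xi Y Yi k)
      (hw : w ∈ normalForms R deli X Xi Y Yi k) : u * w ∈ normalForms R deli X Xi Y Yi k := by
    simpa using mul_mem_normalForms hu (one_mem _) hw
  have hright {w v : B} (hw : w ∈ normalForms R deli X Xi Y Yi k)
      (hv : v ∈ parabolic R X Xi Y Yi k) : w * v ∈ normalForms R deli X Xi Y Yi k := by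
    simpa using mul_mem_normalForms (one_mem _) hv hw
  have hm : murphy X Y k ∈ parabolic R X Xi Y Yi k := murphy_mem_parabolic le_rfl
  have hmi : murphy Xi Yi k ∈ parabolic R X Xi Y Yi k := murphy_inverse_mem_parabolic le_rfl
  have hgP : g ∈ parabolic R X Xi Y Yi k := by
    rcases hg with rfl | rfl | ⟨hk1, rfl | rfl⟩
    · exact one_mem _
    · exact hm
    · exact cupCap_mem deli (X_mem_parabolic hk1 le_rfl) (Xi_mem_parabolic hk1 le_rfl)
    · exact X_mem_parabolic hk1 le_rfl
  rcases hγ with rfl | rfl | rfl | rfl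
  · rw [mul_one]
    exact hright hXM hgP
  · rcases hg with rfl | rfl | ⟨hk1, rfl | rfl⟩
    · rw [mul_one, h.X_e _ (by omega) hk]
      exact Submodule.smul_mem _ _ heM
    · rw [h.X_murphy_e hlam hk]
      exact hleft hmi heM
    · rw [(h.adjacent hlam hk1 hk).X_f_e]
      exact hleft (Xi_mem_parabolic hk1 le_rfl) heM
    · rw [← (h.adjacent hlam hk1 hk).f_e_eq]
      exact hleft (cupCap_mem deli hgP (Xi_mem_parabolic hk1 le_rfl)) heM
  · rcases hg with rfl | rfl | ⟨hk1, rfl | rfl⟩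
    · rw [mul_one, hXX]
      exact sub_mem (add_mem (basic_mem_normalForms (by simp)) (Submodule.smul_mem _ _ hXM))
        (Submodule.smul_mem _ _ heM)
    · exact hYM
    · rw [(h.adjacent hlam hk1 hk).X_f_X]
      have hXi : Xi k ∈ parabolic R X Xi Y Yi k := Xi_mem_parabolic hk1 le_rfl
      exact hright (hleft hXi heM) hXi
    · rw [← h.braid k hk1 hk]
      exact hright (hleft hgP hXM) hgP
  · rw [mul_assoc, ← (h.murphy_commute hk hgP).eq, ← mul_assoc]
    refine hright ?_ hgP
    have : X (k + 1) * murphy X Y (k + 1) = murphy X Y k * X (k + 1) +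
        del • murphy X Y (k + 1) -
          (del * lam) • (cupCap deli (X (k + 1)) (Xi (k + 1)) * murphy Xi Yi k) := by
      rw [← h.e_murphy_X hlam hk]
      simp only [murphy]
      rw [← mul_assoc, ← mul_assoc, hXX]
      simp only [sub_mul, add_mul, one_mul, smul_mul_assoc]
    rw [this]
    exact sub_mem (add_mem (hleft hm hXM) (Submodule.smul_mem _ _ hYM))
      (Submodule.smul_mem _ _ (hright heM hmi))

theorem X_mul_mem (h : TypeBRelations lam lami deli q0 q1 N X Xi Y Yi)
    (hlam : lam * lami = 1) {del : R} (hdel : del * deli = 1) {k : ℕ} (hk : k + 1 ≤ N)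
    (hspan : ∀ u ∈ parabolic R X Xi Y Yi k,
      u ∈ Submodule.span R (centralizedWords R deli X Xi Y Yi k))
    {w : B} (hw : w ∈ normalForms R deli X Xi Y Yi k) :
    X (k + 1) * w ∈ normalForms R deli X Xi Y Yi k := by
  induction hw using Submodule.span_induction with
  | zero => simp
  | add w w' _ _ hw hw' => rw [mul_add]; exact add_mem hw hw'
  | smul c w _ hw => rw [mul_smul_comm]; exact Submodule.smul_mem _ c hw
  | mem w hw =>
    obtain ⟨u, hu, v, hv, γ, hγ, rfl⟩ := hw
    suffices X (k + 1) * u * γ ∈ normalForms R deli X Xi Y Yi k by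
      have := mul_mem_normalForms (one_mem _) hv this
      simpa only [one_mul, mul_assoc] using this
    replace hu := hspan u hu
    clear hv v
    induction hu using Submodule.span_induction with
    | zero => simp
    | add w w' _ _ hw hw' => rw [mul_add, add_mul]; exact add_mem hw hw'
    | smul c w _ hw =>
      rw [mul_smul_comm, smul_mul_assoc]; exact Submodule.smul_mem _ c hw
    | mem u hu =>
      obtain ⟨a, ha, b, hb, hXa, hXb, g, hg, rfl⟩ := hu
      have hbγ : γ * b = b * γ := by
        rcases hγ with rfl | rfl | rfl | rfl
        · simp
        · exact (semiconjBy_cupCap deli (h.X_mul (k + 1) (by omega) hk)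
            (h.Xi_mul (k + 1) (by omega) hk) hXb.symm).eq.symm
        · exact hXb.eq
        · exact (h.murphy_commute hk hb).eq
      have heq : X (k + 1) * (a * g * b) * γ = a * (X (k + 1) * g * γ) * b := by
        calc X (k + 1) * (a * g * b) * γ = X (k + 1) * a * g * (b * γ) := by
              simp only [mul_assoc]
          _ = a * (X (k + 1) * g * γ) * b := by
              rw [hXa.eq, ← hbγ]; simp only [mul_assoc]
      rw [heq]
      exact mul_mem_normalForms ha hb (h.X_mul_mul_mem hlam hdel hk hg hγ)

theorem parabolic_le_normalForms (h : TypeBRelations lam lami deli q0 q1 N X Xi Y Yi)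
    (hlam : lam * lami = 1) {del : R} (hdel : del * deli = 1) {k : ℕ} (hk : k + 1 ≤ N)
    (hspan : ∀ u ∈ parabolic R X Xi Y Yi k,
      u ∈ Submodule.span R (centralizedWords R deli X Xi Y Yi k))
    {u : B} (hu : u ∈ parabolic R X Xi Y Yi (k + 1)) :
    u ∈ normalForms R deli X Xi Y Yi k := by
  have hX {w : B} (hw : w ∈ normalForms R deli X Xi Y Yi k) :=
    h.X_mul_mem hlam hdel hk hspan hw
  have hleft {u w : B} (hu : u ∈ parabolic R X Xi Y Yi k)
      (hw : w ∈ normalForms R deli X Xi Y Yi k) : u * w ∈ normalForms R deli X Xi Y Yi k := by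
    simpa using mul_mem_normalForms hu (one_mem _) hw
  have hXi : Xi (k + 1) = X (k + 1) - del • 1 + lami • (1 + del • X (k + 1) -
      X (k + 1) * X (k + 1)) := by
    have h1 := sub_inverse_eq hdel (X (k + 1)) (Xi (k + 1))
    have h2 := mul_self_eq hdel (h.X_mul (k + 1) (by omega) hk) (h.X_e (k + 1) (by omega) hk)
    have h3 : lami * (del * lam) = del := by rw [mul_left_comm, mul_comm lami, hlam, mul_one]
    rw [h2, sub_sub_cancel, smul_smul, h3, sub_add, ← smul_sub, ← h1, sub_sub_cancel]
  suffices ∀ w ∈ normalForms R deli X Xi Y Yi k, u * w ∈ normalForms R deli X Xi Y Yi k by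
    simpa using this 1 (basic_mem_normalForms (by simp))
  refine Algebra.adjoin_induction (p := fun u _ ↦ ∀ w ∈ normalForms R deli X Xi Y Yi k,
    u * w ∈ normalForms R deli X Xi Y Yi k) ?_ ?_ ?_ ?_ hu
  · rintro u (rfl | rfl | ⟨i, h1, h2, hu⟩) w hw
    · exact hleft (Y_mem_parabolic k) hw
    · exact hleft (Yi_mem_parabolic k) hw
    · rcases Nat.lt_or_ge i (k + 1) with hi | hi
      · rcases hu with rfl | rfl
        · exact hleft (X_mem_parabolic h1 (by omega)) hw
        · exact hleft (Xi_mem_parabolic h1 (by omega)) hw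
      · obtain rfl : i = k + 1 := by omega
        rcases hu with rfl | rfl
        · exact hX hw
        · rw [hXi]
          simp only [add_mul, sub_mul, smul_mul_assoc, one_mul, mul_assoc]
          exact add_mem (sub_mem (hX hw) (Submodule.smul_mem _ _ hw))
            (Submodule.smul_mem _ _ (sub_mem (add_mem hw (Submodule.smul_mem _ _ (hX hw)))
              (hX (hX hw))))
  · intro r w hw
    rw [← Algebra.smul_def]
    exact Submodule.smul_mem _ r hw
  · intro u v _ _ hu hv w hw
    rw [add_mul]
    exact add_mem (hu w hw) (hv w hw)
  · intro u v _ _ hu hv w hw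
    rw [mul_assoc]
    exact hu _ (hv w hw)

theorem parabolic_zero_le_span (h : TypeBRelations lam lami deli q0 q1 N X Xi Y Yi) {q0i : R}
    (hq0 : q0 * q0i = 1) {u : B} (hu : u ∈ parabolic R X Xi Y Yi 0) :
    u ∈ Submodule.span R (centralizedWords R deli X Xi Y Yi 0) := by
  have h1 : (1 : B) ∈ Submodule.span R (centralizedWords R deli X Xi Y Yi 0) :=
    Submodule.subset_span ⟨1, one_mem _, 1, one_mem _, Commute.one_right _, Commute.one_right _,
      1, Or.inl rfl, by simp⟩
  have hY : Y ∈ Submodule.span R (centralizedWords R deli X Xi Y Yi 0) :=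
    Submodule.subset_span ⟨1, one_mem _, 1, one_mem _, Commute.one_right _, Commute.one_right _,
      Y, Or.inr (Or.inl rfl), by simp⟩
  have hspan : Submodule.span R {1, Y} ≤
      Submodule.span R (centralizedWords R deli X Xi Y Yi 0) := by
    rw [Submodule.span_le]
    rintro a (rfl | rfl)
    · exact h1
    · exact hY
  have hYmul : ∀ w ∈ Submodule.span R {1, Y}, Y * w ∈ Submodule.span R {1, Y} := by
    intro w hw
    obtain ⟨a, b, rfl⟩ := Submodule.mem_span_pair.1 hw
    refine Submodule.mem_span_pair.2 ⟨b * q0, a + b * q1, ?_⟩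
    simp only [mul_add, mul_smul_comm, h.Y_sq, smul_add, smul_smul, mul_one, add_smul]
    abel
  have hYi : Yi = q0i • (Y - q1 • 1) := by
    have := congrArg (· * Yi) h.Y_sq
    simp only [add_mul, mul_assoc, smul_mul_assoc, h.Y_mul, mul_one, one_mul] at this
    rw [this, add_sub_cancel_left, smul_smul, mul_comm, hq0, one_smul]
  apply hspan
  suffices ∀ w ∈ Submodule.span R {1, Y}, u * w ∈ Submodule.span R {1, Y} by
    simpa using this 1 (Submodule.subset_span (by simp))
  refine Algebra.adjoin_induction (p := fun u _ ↦ ∀ w ∈ Submodule.span R {1, Y},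
    u * w ∈ Submodule.span R {1, Y}) ?_ ?_ ?_ ?_ hu
  · rintro u (rfl | rfl | ⟨i, hi, hi', -⟩) w hw
    · exact hYmul w hw
    · rw [hYi, smul_mul_assoc, sub_mul, smul_mul_assoc, one_mul]
      exact Submodule.smul_mem _ _ (sub_mem (hYmul w hw) (Submodule.smul_mem _ _ hw))
    · omega
  · intro r w hw
    rw [← Algebra.smul_def]
    exact Submodule.smul_mem _ r hw
  · intro u v _ _ hu hv w hw
    rw [add_mul]
    exact add_mem (hu w hw) (hv w hw)
  · intro u v _ _ hu hv w hw
    rw [mul_assoc]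
    exact hu _ (hv w hw)

theorem parabolic_le_span (h : TypeBRelations lam lami deli q0 q1 N X Xi Y Yi)
    (hlam : lam * lami = 1) {del q0i : R} (hdel : del * deli = 1) (hq0 : q0 * q0i = 1) {k : ℕ}
    (hk : k + 1 ≤ N) : ∀ u ∈ parabolic R X Xi Y Yi k,
      u ∈ Submodule.span R (centralizedWords R deli X Xi Y Yi k) := by
  induction k with
  | zero => exact fun u hu ↦ h.parabolic_zero_le_span hq0 hu
  | succ k ih =>
    intro u hu
    have hu := h.parabolic_le_normalForms hlam hdel (by omega) (ih (by omega)) hu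
    refine Submodule.span_mono ?_ hu
    rintro w ⟨a, ha, b, hb, γ, hγ, rfl⟩
    refine ⟨a, parabolic_mono (by omega) ha, b, parabolic_mono (by omega) hb,
      h.X_commute_parabolic le_rfl hk ha, h.X_commute_parabolic le_rfl hk hb, γ, ?_, rfl⟩
    rcases hγ with rfl | rfl | rfl | rfl <;> simp

end TypeBRelations

end Tangle

section Presentation

variable (R : Type) [CommRing R] (lam lami deli q0 q1 A : R) (n : ℕ)

local notation "π" => mk R lam lami deli q0 q1 A n

variable {n} in
theorem XX_eq {i : ℕ} (h1 : 1 ≤ i) (h2 : i ≤ n - 1) :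
    XX R lam lami deli q0 q1 A n i = π (fX R ⟨i - 1, by omega⟩) :=
  dif_pos (by omega)

variable {n} in
theorem XXi_eq {i : ℕ} (h1 : 1 ≤ i) (h2 : i ≤ n - 1) :
    XXi R lam lami deli q0 q1 A n i = π (fXinv R ⟨i - 1, by omega⟩) :=
  dif_pos (by omega)

variable {n} in
theorem cupCap_eq {i : ℕ} (h1 : 1 ≤ i) (h2 : i ≤ n - 1) :
    cupCap deli (XX R lam lami deli q0 q1 A n i) (XXi R lam lami deli q0 q1 A n i) =
      π (fe R deli ⟨i - 1, by omega⟩) := by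
  rw [XX_eq _ _ _ _ _ _ _ h1 h2, XXi_eq _ _ _ _ _ _ _ h1 h2]
  simp [cupCap, fe]

variable {R lam lami deli q0 q1 A n} in
theorem mk_eq_of_rel {a b : FreeAlgebra R (Gen n)} (h : Rel R lam lami deli q0 q1 A n a b) :
    π a = π b :=
  RingQuot.mkAlgHom_rel R h

theorem typeBRelations (hn : 2 ≤ n) : TypeBRelations lam lami deli q0 q1 (n - 1)
    (XX R lam lami deli q0 q1 A n) (XXi R lam lami deli q0 q1 A n)
    (YY R lam lami deli q0 q1 A n) (YYi R lam lami deli q0 q1 A n) := by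
  have hn0 : 0 < n := by omega
  have hY : YY R lam lami deli q0 q1 A n = π (fY R hn0) := dif_pos hn0
  have hYi : YYi R lam lami deli q0 q1 A n = π (fYinv R hn0) := dif_pos hn0
  have hX {i : ℕ} (h1 : 1 ≤ i) (h2 : i ≤ n - 1) := XX_eq R lam lami deli q0 q1 A h1 h2
  have hXi {i : ℕ} (h1 : 1 ≤ i) (h2 : i ≤ n - 1) := XXi_eq R lam lami deli q0 q1 A h1 h2
  have he {i : ℕ} (h1 : 1 ≤ i) (h2 : i ≤ n - 1) := cupCap_eq R lam lami deli q0 q1 A h1 h2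
  constructor
  case X_mul =>
    intro i h1 h2
    simpa [hX h1 h2, hXi h1 h2] using mk_eq_of_rel (.XXinv ⟨i - 1, by omega⟩)
  case Xi_mul =>
    intro i h1 h2
    simpa [hX h1 h2, hXi h1 h2] using mk_eq_of_rel (.XinvX ⟨i - 1, by omega⟩)
  case Y_mul => simpa [hY, hYi] using mk_eq_of_rel (.YYinv hn0)
  case Yi_mul => simpa [hY, hYi] using mk_eq_of_rel (.YinvY hn0)
  case comm =>
    intro i j h1 hij hj
    rw [hX h1 (by omega), hX (by omega) hj]
    simpa [Commute, SemiconjBy] using (mk_eq_of_rel (.comm ⟨j - 1, by omega⟩ ⟨i - 1, by omega⟩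
      (by simp only; omega))).symm
  case braid =>
    intro i h1 hi
    rw [hX h1 (by omega), hX (by omega) hi]
    simpa using mk_eq_of_rel (.braid ⟨i - 1, by omega⟩ ⟨i + 1 - 1, by omega⟩
      (by simp only; omega))
  case X_e =>
    intro i h1 h2
    rw [he h1 h2, hX h1 h2]
    simpa using mk_eq_of_rel (.Xe ⟨i - 1, by omega⟩)
  case e_X =>
    intro i h1 h2
    rw [he h1 h2, hX h1 h2]
    simpa using mk_eq_of_rel (.eX ⟨i - 1, by omega⟩)
  case e_X_e =>
    intro i h1 h2
    rw [he (by omega) h2, hX h1 (by omega)]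
    simpa using mk_eq_of_rel (.eXe ⟨i + 1 - 1, by omega⟩ ⟨i - 1, by omega⟩
      (by simp only; omega))
  case e_Xi_e =>
    intro i h1 h2
    rw [he (by omega) h2, hXi h1 (by omega)]
    simpa using mk_eq_of_rel (.eXinve ⟨i + 1 - 1, by omega⟩ ⟨i - 1, by omega⟩
      (by simp only; omega))
  case XYXY =>
    intro h1
    rw [hX le_rfl h1, hY]
    simpa using mk_eq_of_rel (.bYXYX hn0 ⟨1 - 1, by omega⟩ rfl)
  case Y_sq => simpa [hY] using mk_eq_of_rel (.Ysq hn0)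
  case YXY_e =>
    intro h1
    rw [he le_rfl h1, hX le_rfl h1, hY]
    simpa using mk_eq_of_rel (.YXYe hn0 ⟨1 - 1, by omega⟩ rfl)
  case Y_comm =>
    intro i h1 h2
    rw [hX (by omega) h2, hY]
    simpa [Commute, SemiconjBy] using mk_eq_of_rel (.Ycomm hn0 ⟨i - 1, by omega⟩ (by simp only; omega))

theorem Yp_succ (k : ℕ) : Yp R lam lami deli q0 q1 A n (k + 1) =
    murphy (XX R lam lami deli q0 q1 A n) (YY R lam lami deli q0 q1 A n) k := by
  induction k with
  | zero => rfl
  | succ k ih => rw [Yp, ih, murphy]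

theorem mem_sub_pred (u : BB R lam lami deli q0 q1 A n) :
    u ∈ sub R lam lami deli q0 q1 A n (n - 1) := by
  obtain ⟨f, rfl⟩ := RingQuot.mkAlgHom_surjective R (Rel R lam lami deli q0 q1 A n) u
  change π f ∈ _
  induction f using FreeAlgebra.induction with
  | grade0 r => rw [AlgHom.commutes]; exact Subalgebra.algebraMap_mem _ r
  | mul a b ha hb => rw [map_mul]; exact mul_mem ha hb
  | add a b ha hb => rw [map_add]; exact add_mem ha hb
  | grade1 g =>
    refine Algebra.subset_adjoin ?_
    cases g with
    | X i =>
      exact Or.inr (Or.inr ⟨i + 1, by omega, i.isLt,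
        Or.inl (XX_eq R lam lami deli q0 q1 A (i := i + 1) (by omega) i.isLt).symm⟩)
    | Xinv i =>
      exact Or.inr (Or.inr ⟨i + 1, by omega, i.isLt,
        Or.inr (XXi_eq R lam lami deli q0 q1 A (i := i + 1) (by omega) i.isLt).symm⟩)
    | Y h =>
      refine Or.inl ?_
      rw [YY, dif_pos h, fY]
    | Yinv h =>
      refine Or.inr (Or.inl ?_)
      rw [YYi, dif_pos h, fYinv]

end Presentation

/-- Proposition 9 (normal form with `Y'`): every element of `BB_n(R)` is a linear combination
of words `w₁ γ w₂` with `w₁, w₂` in the image of `BB_{n-1}(R)` and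
`γ ∈ {1, e_{n−1}, X_{n−1}, Y'_n}`. -/
theorem BB_normal_form_Ypn (R : Type) [CommRing R] [IsDomain R]
    (q qi lam lami del deli q0 q0i q1 A x : R)
    (hq : q * qi = 1) (hlam : lam * lami = 1) (hdel : del * deli = 1) (hq0u : q0 * q0i = 1)
    (hdelta : del = q - qi) (hx : x * del = del - lam + lami)
    (hA : A * (1 - q0 * lam) = q1 * x) (hq0 : q0 = qi) (n : ℕ) (hn : 2 ≤ n) :
    Submodule.span R {w : BB R lam lami deli q0 q1 A n | ∃ w1 ∈ sub R lam lami deli q0 q1 A n (n - 2), ∃ w2 ∈ sub R lam lami deli q0 q1 A n (n - 2),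
      ∃ γ ∈ ({1, ee R lam lami deli q0 q1 A n (n - 1), XX R lam lami deli q0 q1 A n (n - 1), Yp R lam lami deli q0 q1 A n n} : Set (BB R lam lami deli q0 q1 A n)),
      w = w1 * γ * w2} = ⊤ := by
  obtain ⟨m, rfl⟩ : ∃ m, n = m + 2 := ⟨n - 2, by omega⟩
  have h := typeBRelations R lam lami deli q0 q1 A (m + 2) hn
  rw [eq_top_iff]
  intro u _
  have hu := h.parabolic_le_normalForms hlam hdel (k := m) (by omega)
    (h.parabolic_le_span hlam hdel hq0u (by omega))
    (mem_sub_pred R lam lami deli q0 q1 A (m + 2) u)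
  rw [normalForms, ← Yp_succ] at hu
  exact hu

end BMWB
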